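/- arXiv:0902.2235 — 3 statements merged into one kernel-verified Lean document; each statement's English description precedes it below -/
import Mathlib

section
/- Let G, Ḡ ∈ F[z]^{k×n} be basic reduced matrices of the same degree δ all of whose row degrees are positive. Then G and Ḡ are monomially equivalent if and only if Λ(G) = Λ(Ḡ), i.e. if and only if for all X, Y ∈ F^δ and every w ∈ ℕ₀ the number of u ∈ F^k with Y = XA + uB and wt(XC + uD) = w equals the number of u ∈ F^k with Y = XĀ + uB̄ and wt(XC̄ + uD̄) = w, where (A,B,C,D) and (Ā,B̄,C̄,D̄) are the CCFs of G and Ḡ. -/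
open Matrix Polynomial

variable {F : Type*} [Field F]

/-- A polynomial matrix is basic if its evaluation at every point of the algebraic
closure has full row rank. -/
def IsBasic {k n : ℕ} (G : Matrix (Fin k) (Fin n) (Polynomial F)) : Prop :=
  ∀ lam : AlgebraicClosure F, (G.map fun p => (Polynomial.aeval lam) p).rank = k

/-- A monomial matrix over `F`: permutation times invertible diagonal. -/
def IsMonomialMatrix {n : ℕ} (M : Matrix (Fin n) (Fin n) F) : Prop :=
  ∃ (σ : Equiv.Perm (Fin n)) (d : Fin n → Fˣ),
    ∀ i j, M i j = if σ i = j then (d j : F) else 0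

/-- The `i`-th row degree of a polynomial matrix. -/
def rowDeg {k n : ℕ} (G : Matrix (Fin k) (Fin n) (Polynomial F)) (i : Fin k) : ℕ :=
  Finset.univ.sup fun j => (G i j).natDegree

/-- The (internal) degree of a polynomial matrix: the maximal degree of its `k × k` minors. -/
noncomputable def degMat {k n : ℕ} (G : Matrix (Fin k) (Fin n) (Polynomial F)) : ℕ :=
  Finset.univ.sup fun f : Fin k ↪ Fin n => (Matrix.det fun i i' => G i (f i')).natDegree

/-- A polynomial matrix is reduced if the sum of its row degrees equals its degree. -/
noncomputable def IsRowReduced {k n : ℕ} (G : Matrix (Fin k) (Fin n) (Polynomial F)) : Prop :=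
  (∑ i, rowDeg G i) = degMat G

/-- Index set for the state space of the controller canonical form with row degrees `ν`. -/
abbrev StateIdx {k : ℕ} (ν : Fin k → ℕ) := (i : Fin k) × Fin (ν i)

/-- The matrix `A` of the controller canonical form. -/
def ccfA {k : ℕ} (ν : Fin k → ℕ) : Matrix (StateIdx ν) (StateIdx ν) F :=
  fun p q => if p.1 = q.1 ∧ (q.2 : ℕ) = (p.2 : ℕ) + 1 then 1 else 0

/-- The matrix `B` of the controller canonical form. -/
def ccfB {k : ℕ} (ν : Fin k → ℕ) : Matrix (Fin k) (StateIdx ν) F :=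
  fun i q => if i = q.1 ∧ (q.2 : ℕ) = 0 then 1 else 0

/-- The matrix `C` of the controller canonical form of `G`. -/
def ccfC {k n : ℕ} (G : Matrix (Fin k) (Fin n) (Polynomial F)) :
    Matrix (StateIdx (rowDeg G)) (Fin n) F :=
  fun p j => (G p.1 j).coeff ((p.2 : ℕ) + 1)

/-- The matrix `D` of the controller canonical form of `G`. -/
def ccfD {k n : ℕ} (G : Matrix (Fin k) (Fin n) (Polynomial F)) :
    Matrix (Fin k) (Fin n) F :=
  fun i j => (G i j).coeff 0

/-- The entry of the weight adjacency matrix of `G` at the pair of states `(X, Y)`: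
the coefficient of `W^w` is the number of inputs `u` realizing the state transition
`X → Y` whose corresponding output has Hamming weight `w`. -/
noncomputable def WAMe {k n : ℕ} [DecidableEq F] (G : Matrix (Fin k) (Fin n) (Polynomial F))
    (X Y : StateIdx (rowDeg G) → F) (w : ℕ) : ℕ :=
  Set.ncard {u : Fin k → F |
    X ᵥ* ccfA (rowDeg G) + u ᵥ* ccfB (rowDeg G) = Y ∧
    hammingNorm (X ᵥ* ccfC G + u ᵥ* ccfD G) = w}

/-- The canonical enumeration of the state indices. -/
def encIdx {k : ℕ} (ν : Fin k → ℕ) (p : StateIdx ν) : ℕ :=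
  (∑ i' ∈ Finset.univ.filter (fun i' => i' < p.1), ν i') + (p.2 : ℕ)

theorem encIdx_lt {k : ℕ} (ν : Fin k → ℕ) (p : StateIdx ν) : encIdx ν p < ∑ i, ν i := by
  have h1 : (p.2 : ℕ) < ν p.1 := p.2.isLt
  have h2 : ν p.1 ≤ ∑ i' ∈ Finset.univ.filter (fun i' => ¬ i' < p.1), ν i' :=
    Finset.single_le_sum (fun i _ => Nat.zero_le _) (by simp)
  have h3 := Finset.sum_filter_add_sum_filter_not Finset.univ (fun i' => i' < p.1) ν
  unfold encIdx
  omega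

/-- The canonical identification of the state space with `Fin δ`. -/
def stateEnc {k : ℕ} (ν : Fin k → ℕ) {δ : ℕ} (h : (∑ i, ν i) = δ) (p : StateIdx ν) : Fin δ :=
  ⟨encIdx ν p, h ▸ encIdx_lt ν p⟩

/-- The entry of the weight adjacency matrix of `G` at states `X, Y ∈ F^δ`, using the
canonical identification of the state space of the controller canonical form with `F^δ`. -/
noncomputable def WAMfin {k n δ : ℕ} [DecidableEq F] (G : Matrix (Fin k) (Fin n) (Polynomial F))
    (h : (∑ i, rowDeg G i) = δ) (X Y : Fin δ → F) (w : ℕ) : ℕ :=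
  WAMe G (fun p => X (stateEnc (rowDeg G) h p)) (fun p => Y (stateEnc (rowDeg G) h p)) w

section FiniteFieldFunctionals

variable {V J : Type*} [AddCommGroup V] [Module F V] [Fintype V] [Fintype J]

theorem card_mul_card_ne_zero_of_ne_zero [Fintype F] [DecidableEq F] (f : Module.Dual F V)
    (hf : f ≠ 0) :
    Fintype.card F * (Finset.univ.filter fun x => f x ≠ 0).card =
      Fintype.card V * (Fintype.card F - 1) := by
  have hsurj : Function.Surjective f := LinearMap.surjective hf
  have hker : Nat.card V = Nat.card (LinearMap.ker f) * Nat.card F := by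
    rw [Submodule.card_eq_card_quotient_mul_card (LinearMap.ker f),
      Nat.card_congr (f.quotKerEquivOfSurjective hsurj).toEquiv]
  have hcard : Nat.card (LinearMap.ker f) = (Finset.univ.filter fun x => f x = 0).card := by
    simp [← Fintype.card_subtype, ← Nat.card_eq_fintype_card]
  have hsplit := Finset.card_filter_add_card_filter_not (s := (Finset.univ : Finset V))
    (fun x => f x = 0)
  rw [Nat.card_eq_fintype_card, hcard, Nat.card_eq_fintype_card] at hker
  rw [Finset.card_univ] at hsplit
  obtain ⟨q, hq⟩ : ∃ q, Fintype.card F = q + 1 := ⟨_, (Nat.succ_pred Fintype.card_ne_zero).symm⟩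
  rw [hq] at hker ⊢
  simp only [Nat.add_sub_cancel, ne_eq]
  nlinarith

/-- Families of functionals with the same weights have the same number of members
not vanishing on a given subspace. -/
theorem card_domRestrict_ne_zero_eq [Fintype F] [DecidableEq F] {P Q : J → Module.Dual F V}
    (h : ∀ x, hammingNorm (fun j => P j x) = hammingNorm (fun j => Q j x))
    (U : Submodule F V) [DecidablePred fun j => (P j).domRestrict U ≠ 0]
    [DecidablePred fun j => (Q j).domRestrict U ≠ 0] :
    (Finset.univ.filter fun j => (P j).domRestrict U ≠ 0).card =
      (Finset.univ.filter fun j => (Q j).domRestrict U ≠ 0).card := by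
  classical
  have key : ∀ R : J → Module.Dual F V,
      Fintype.card F * ∑ x : U, hammingNorm (fun j => R j x) =
        (Finset.univ.filter fun j => (R j).domRestrict U ≠ 0).card *
          (Fintype.card U * (Fintype.card F - 1)) := by
    intro R
    simp only [hammingNorm, Finset.card_filter]
    rw [Finset.sum_comm, Finset.mul_sum, Finset.sum_mul]
    refine Finset.sum_congr rfl fun j _ => ?_
    rw [← Finset.card_filter]
    split_ifs with hj
    · rw [one_mul, ← card_mul_card_ne_zero_of_ne_zero _ hj]
      rfl
    · rw [not_not] at hj
      have : ∀ x : U, R j x = 0 := fun x => LinearMap.congr_fun hj x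
      simp [this]
  have hP := key P
  simp only [h] at hP
  have hpos : 0 < Fintype.card U * (Fintype.card F - 1) :=
    Nat.mul_pos Fintype.card_pos (Nat.sub_pos_of_lt Fintype.one_lt_card)
  have := Nat.eq_of_mul_eq_mul_right hpos (hP.symm.trans (key Q))
  convert this

theorem card_domRestrict_eq_zero_eq [Fintype F] [DecidableEq F] {P Q : J → Module.Dual F V}
    (h : ∀ x, hammingNorm (fun j => P j x) = hammingNorm (fun j => Q j x))
    (U : Submodule F V) :
    Nat.card {j // (P j).domRestrict U = 0} = Nat.card {j // (Q j).domRestrict U = 0} := by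
  classical
  have hP := Finset.card_filter_add_card_filter_not (s := (Finset.univ : Finset J))
    (fun j => (P j).domRestrict U = 0)
  have hQ := Finset.card_filter_add_card_filter_not (s := (Finset.univ : Finset J))
    (fun j => (Q j).domRestrict U = 0)
  have := card_domRestrict_ne_zero_eq h U
  simp only [ne_eq] at this
  rw [Nat.card_eq_fintype_card, Nat.card_eq_fintype_card, Fintype.card_subtype,
    Fintype.card_subtype]
  omega

theorem card_domRestrict_ker_eq_zero (P : J → Module.Dual F V) {f : Module.Dual F V}
    (hf : f ≠ 0) :
    Nat.card {j // (P j).domRestrict (LinearMap.ker f) = 0} =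
      Nat.card {j // P j ∈ MulAction.orbit Fˣ f} + Nat.card {j // P j = 0} := by
  classical
  have hiff : ∀ g : Module.Dual F V, g.domRestrict (LinearMap.ker f) = 0 ↔
      g ∈ MulAction.orbit Fˣ f ∨ g = 0 := by
    intro g
    constructor
    · intro hg
      have hle : LinearMap.ker f ≤ LinearMap.ker g := fun x hx =>
        LinearMap.congr_fun hg ⟨x, hx⟩
      have hmem : g ∈ Submodule.span F (Set.range fun _ : Unit => f) :=
        mem_span_of_iInf_ker_le_ker (by simpa using hle)
      rw [Set.range_const, Submodule.mem_span_singleton] at hmem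
      obtain ⟨c, rfl⟩ := hmem
      by_cases hc : c = 0
      · right; simp [hc]
      · left; exact ⟨Units.mk0 c hc, rfl⟩
    · rintro (⟨c, rfl⟩ | rfl)
      · ext x
        have hx : f x = 0 := x.2
        simp [Units.smul_def, hx]
      · ext x; simp
  have hdisj : Disjoint (fun j => P j ∈ MulAction.orbit Fˣ f) (fun j => P j = 0) := by
    rw [Pi.disjoint_iff]
    intro j
    rw [Prop.disjoint_iff]
    by_contra! hj
    obtain ⟨⟨c, hc⟩, h0⟩ := hj
    rw [h0] at hc
    exact hf ((smul_eq_zero_iff_eq c).1 hc)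
  rw [Nat.card_congr (Equiv.subtypeEquivRight fun j => hiff (P j)), Nat.card_eq_fintype_card,
    Fintype.card_subtype_or_disjoint _ _ hdisj, Nat.card_eq_fintype_card,
    Nat.card_eq_fintype_card]

/-- The MacWilliams extension theorem for families of linear functionals over a finite field. -/
theorem exists_perm_smul_of_hammingNorm_eq [Fintype F] [DecidableEq F] {P Q : J → Module.Dual F V}
    (h : ∀ x, hammingNorm (fun j => P j x) = hammingNorm (fun j => Q j x)) :
    ∃ (σ : Equiv.Perm J) (d : J → Fˣ), ∀ j, Q (σ j) = d j • P j := by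
  classical
  have hzero : Nat.card {j // P j = 0} = Nat.card {j // Q j = 0} := by
    have hiff : ∀ g : Module.Dual F V, g.domRestrict ⊤ = 0 ↔ g = 0 := fun g =>
      ⟨fun hg => LinearMap.ext fun x => LinearMap.congr_fun hg ⟨x, trivial⟩,
        fun hg => by rw [hg]; rfl⟩
    simpa only [hiff] using card_domRestrict_eq_zero_eq h ⊤
  have horbit : ∀ f : Module.Dual F V,
      Nat.card {j // P j ∈ MulAction.orbit Fˣ f} = Nat.card {j // Q j ∈ MulAction.orbit Fˣ f} := by
    intro f
    by_cases hf : f = 0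
    · subst hf
      have : MulAction.orbit Fˣ (0 : Module.Dual F V) = {0} := by
        ext g; simp [MulAction.mem_orbit_iff, eq_comm]
      simpa [this] using hzero
    · have := card_domRestrict_eq_zero_eq h (LinearMap.ker f)
      rw [card_domRestrict_ker_eq_zero P hf, card_domRestrict_ker_eq_zero Q hf, hzero] at this
      exact Nat.add_right_cancel this
  let cls : Module.Dual F V → MulAction.orbitRel.Quotient Fˣ (Module.Dual F V) :=
    Quotient.mk _
  have hfiber : ∀ c, Nonempty ({j // cls (P j) = c} ≃ {j // cls (Q j) = c}) := by
    intro c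
    induction c using Quotient.inductionOn with | _ f
    have hmem : ∀ g, cls g = ⟦f⟧ ↔ g ∈ MulAction.orbit Fˣ f := fun g => Quotient.eq
    simp only [hmem]
    exact ⟨Fintype.equivOfCardEq (by simpa only [Nat.card_eq_fintype_card] using horbit f)⟩
  let σ : Equiv.Perm J := Equiv.ofFiberEquiv fun c => (hfiber c).some
  have hσ : ∀ j, ∃ c : Fˣ, c • P j = Q (σ j) := by
    intro j
    have hj : cls (Q (σ j)) = cls (P j) :=
      Equiv.ofFiberEquiv_map (f := fun j => cls (P j)) (g := fun j => cls (Q j)) _ j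
    exact Quotient.eq.1 hj
  choose d hd using hσ
  exact ⟨σ, d, fun j => (hd j).symm⟩

end FiniteFieldFunctionals

section StateEncoding

variable {k : ℕ} {ν ν' : Fin k → ℕ} {δ : ℕ}

theorem sum_lt_add_le_sum_lt (ν : Fin k → ℕ) {i j : Fin k} (hij : i < j) :
    (∑ i' ∈ Finset.univ.filter (fun i' => i' < i), ν i') + ν i ≤
      ∑ i' ∈ Finset.univ.filter (fun i' => i' < j), ν i' := by
  rw [add_comm, ← Finset.sum_insert (s := Finset.univ.filter (fun i' => i' < i)) (by simp)]
  refine Finset.sum_le_sum_of_subset fun l hl => ?_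
  simp only [Finset.mem_insert, Finset.mem_filter, Finset.mem_univ, true_and] at hl ⊢
  rcases hl with rfl | hl
  · exact hij
  · exact hl.trans hij

theorem encIdx_injective (ν : Fin k → ℕ) : Function.Injective (encIdx ν) := by
  rintro ⟨i, a⟩ ⟨j, b⟩ h
  simp only [encIdx] at h
  rcases lt_trichotomy i j with hij | rfl | hij
  · have := sum_lt_add_le_sum_lt ν hij
    have := a.isLt
    omega
  · have : a = b := Fin.ext (by omega)
    rw [this]
  · have := sum_lt_add_le_sum_lt ν hij
    have := b.isLt
    omega

theorem stateEnc_bijective (h : (∑ i, ν i) = δ) : Function.Bijective (stateEnc ν h) := by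
  refine (Fintype.bijective_iff_injective_and_card _).2 ⟨fun p q hpq => ?_, by simpa using h⟩
  exact encIdx_injective ν (congrArg Fin.val hpq)

/-- The sizes of the blocks are determined by the positions at which the blocks start. -/
theorem eq_of_range_blockStart_eq (hν : ∀ i, 0 < ν i) (hν' : ∀ i, 0 < ν' i)
    (hsum : (∑ i, ν i) = ∑ i, ν' i)
    (hrange : Set.range (fun i => encIdx ν ⟨i, ⟨0, hν i⟩⟩) =
      Set.range (fun i => encIdx ν' ⟨i, ⟨0, hν' i⟩⟩)) :
    ν = ν' := by
  have hmono : ∀ (μ : Fin k → ℕ) (hμ : ∀ i, 0 < μ i),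
      StrictMono (fun i => encIdx μ ⟨i, ⟨0, hμ i⟩⟩) := by
    intro μ hμ i j hij
    have := sum_lt_add_le_sum_lt μ hij
    have := hμ i
    simp only [encIdx]
    omega
  have hstart := ((hmono ν hν).range_inj (hmono ν' hν')).1 hrange
  have hpre : ∀ i, (∑ i' ∈ Finset.univ.filter (fun i' => i' < i), ν i') =
      ∑ i' ∈ Finset.univ.filter (fun i' => i' < i), ν' i' := by
    intro i
    simpa [encIdx] using congrFun hstart i
  funext i
  have hle : (∑ i' ∈ Finset.univ.filter (fun i' => i' ≤ i), ν i') =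
      ∑ i' ∈ Finset.univ.filter (fun i' => i' ≤ i), ν' i' := by
    by_cases hi : (i : ℕ) + 1 < k
    · have := hpre ⟨i + 1, hi⟩
      simpa only [Fin.lt_def, Fin.le_def, Nat.lt_succ_iff] using this
    · have : Finset.univ.filter (fun i' => i' ≤ i) = Finset.univ :=
        Finset.filter_true_of_mem fun j _ => Fin.le_def.2 (by omega)
      rw [this, hsum]
  have hinsert : Finset.univ.filter (fun i' => i' ≤ i) =
      insert i (Finset.univ.filter (fun i' => i' < i)) := by
    ext j
    simp [le_iff_eq_or_lt]
  rw [hinsert, Finset.sum_insert (by simp), Finset.sum_insert (by simp), hpre i] at hle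
  exact Nat.add_right_cancel hle

theorem ccf_transition_zero (X : StateIdx ν → F) (u : Fin k → F) (p : StateIdx ν)
    (hp : (p.2 : ℕ) = 0) : (X ᵥ* ccfA ν + u ᵥ* ccfB ν) p = u p.1 := by
  simp [Matrix.vecMul, dotProduct, ccfA, ccfB, hp]

theorem ccf_transition_of_ne_zero (u : Fin k → F) (p : StateIdx ν)
    (hp : (p.2 : ℕ) ≠ 0) : ((0 : StateIdx ν → F) ᵥ* ccfA ν + u ᵥ* ccfB ν) p = 0 := by
  simp [Matrix.vecMul, dotProduct, ccfB, hp]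

theorem ccf_input_unique (hν : ∀ i, 0 < ν i) {X : StateIdx ν → F} {u v : Fin k → F}
    (h : X ᵥ* ccfA ν + u ᵥ* ccfB ν = X ᵥ* ccfA ν + v ᵥ* ccfB ν) : u = v := by
  funext i
  have := congrFun h ⟨i, ⟨0, hν i⟩⟩
  rwa [ccf_transition_zero _ _ _ rfl, ccf_transition_zero _ _ _ rfl] at this

end StateEncoding

section Output

variable {k n δ : ℕ}

/-- The `j`-th output coordinate as a linear functional of the state and the input, for a
state space with block sizes `ν`. -/
def ccfOutput (ν : Fin k → ℕ) (G : Matrix (Fin k) (Fin n) F[X]) (j : Fin n) :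
    Module.Dual F ((StateIdx ν → F) × (Fin k → F)) :=
  (LinearMap.proj j ∘ₗ Matrix.vecMulLinear
    (Matrix.of fun (p : StateIdx ν) j => (G p.1 j).coeff ((p.2 : ℕ) + 1))).coprod
    (LinearMap.proj j ∘ₗ Matrix.vecMulLinear (ccfD G))

theorem ccfOutput_single_state (ν : Fin k → ℕ) (G : Matrix (Fin k) (Fin n) F[X]) (j : Fin n)
    (p : StateIdx ν) :
    ccfOutput ν G j (Pi.single p 1, 0) = (G p.1 j).coeff ((p.2 : ℕ) + 1) := by
  simp [ccfOutput]

theorem ccfOutput_single_input (ν : Fin k → ℕ) (G : Matrix (Fin k) (Fin n) F[X]) (j : Fin n)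
    (i : Fin k) :
    ccfOutput ν G j (0, Pi.single i 1) = (G i j).coeff 0 := by
  simp [ccfOutput, ccfD]

theorem WAMfin_eq_ncard [DecidableEq F] (G : Matrix (Fin k) (Fin n) F[X])
    (h : (∑ i, rowDeg G i) = δ) {ν : Fin k → ℕ} (hG : rowDeg G = ν) (hν : (∑ i, ν i) = δ)
    (X Y : Fin δ → F) (w : ℕ) :
    WAMfin G h X Y w = Set.ncard {u : Fin k → F |
      (X ∘ stateEnc ν hν) ᵥ* ccfA ν + u ᵥ* ccfB ν = Y ∘ stateEnc ν hν ∧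
      hammingNorm (fun j => ccfOutput ν G j (X ∘ stateEnc ν hν, u)) = w} := by
  subst hG
  rfl

theorem exists_input_of_WAMfin_eq [Fintype F] [DecidableEq F]
    {G H : Matrix (Fin k) (Fin n) F[X]}
    (hG : (∑ i, rowDeg G i) = δ) (hH : (∑ i, rowDeg H i) = δ)
    (hGH : ∀ (X Y : Fin δ → F) (w : ℕ), WAMfin G hG X Y w = WAMfin H hH X Y w)
    {X Y : Fin δ → F} {u : Fin k → F}
    (hu : (X ∘ stateEnc (rowDeg G) hG) ᵥ* ccfA (rowDeg G) + u ᵥ* ccfB (rowDeg G) =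
      Y ∘ stateEnc (rowDeg G) hG)
    {ν : Fin k → ℕ} (hν : rowDeg H = ν) (hνδ : (∑ i, ν i) = δ) :
    ∃ v : Fin k → F,
      (X ∘ stateEnc ν hνδ) ᵥ* ccfA ν + v ᵥ* ccfB ν = Y ∘ stateEnc ν hνδ ∧
      hammingNorm (fun j => ccfOutput ν H j (X ∘ stateEnc ν hνδ, v)) =
        hammingNorm (fun j => ccfOutput (rowDeg G) G j (X ∘ stateEnc (rowDeg G) hG, u)) := by
  have hcount := hGH X Y
    (hammingNorm (fun j => ccfOutput (rowDeg G) G j (X ∘ stateEnc (rowDeg G) hG, u)))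
  rw [WAMfin_eq_ncard G hG rfl hG, WAMfin_eq_ncard H hH hν hνδ] at hcount
  exact Set.nonempty_of_ncard_ne_zero
    (hcount ▸ Set.ncard_ne_zero_of_mem (a := u) ⟨hu, rfl⟩)

theorem range_blockStart_subset_of_WAMfin_eq [Fintype F] [DecidableEq F]
    {G H : Matrix (Fin k) (Fin n) F[X]}
    (hG : (∑ i, rowDeg G i) = δ) (hH : (∑ i, rowDeg H i) = δ)
    (hGH : ∀ (X Y : Fin δ → F) (w : ℕ), WAMfin G hG X Y w = WAMfin H hH X Y w)
    (hposG : ∀ i, 0 < rowDeg G i) (hposH : ∀ i, 0 < rowDeg H i) :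
    Set.range (fun i => encIdx (rowDeg G) ⟨i, ⟨0, hposG i⟩⟩) ⊆
      Set.range (fun i => encIdx (rowDeg H) ⟨i, ⟨0, hposH i⟩⟩) := by
  rintro _ ⟨i, rfl⟩
  obtain ⟨Y, hY⟩ := (stateEnc_bijective hG).injective.surjective_comp_right
    ((0 : StateIdx (rowDeg G) → F) ᵥ* ccfA (rowDeg G) + (1 : Fin k → F) ᵥ* ccfB (rowDeg G))
  obtain ⟨v, hv, -⟩ := exists_input_of_WAMfin_eq hG hH hGH (X := 0) hY.symm rfl hH
  obtain ⟨p, hp⟩ := (stateEnc_bijective hH).surjective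
    (stateEnc (rowDeg G) hG ⟨i, ⟨0, hposG i⟩⟩)
  have hYG : Y (stateEnc (rowDeg G) hG ⟨i, ⟨0, hposG i⟩⟩) = 1 := by
    have := congrFun hY ⟨i, ⟨0, hposG i⟩⟩
    rw [ccf_transition_zero _ _ _ rfl] at this
    exact this
  have hp0 : (p.2 : ℕ) = 0 := by
    by_contra hne
    have := congrFun hv p
    rw [Pi.zero_comp, ccf_transition_of_ne_zero _ _ hne, Function.comp_apply, hp, hYG] at this
    exact zero_ne_one this
  obtain ⟨i', a⟩ := p
  obtain rfl : a = ⟨0, hposH i'⟩ := Fin.ext hp0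
  exact ⟨i', congrArg Fin.val hp⟩

end Output

section Monomial

variable {k n δ : ℕ}

theorem mul_map_C_monomial_apply (G : Matrix (Fin k) (Fin n) F[X])
    {M : Matrix (Fin n) (Fin n) F} {σ : Equiv.Perm (Fin n)} {d : Fin n → Fˣ}
    (hM : ∀ i j, M i j = if σ i = j then (d j : F) else 0) (i : Fin k) (j : Fin n) :
    (G * M.map fun a => C a) i (σ j) = G i j * C (d (σ j) : F) := by
  simp [Matrix.mul_apply, hM, apply_ite C]

theorem rowDeg_eq_of_monomial {G H : Matrix (Fin k) (Fin n) F[X]} {σ : Equiv.Perm (Fin n)}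
    {d : Fin n → Fˣ} (h : ∀ i j, H i (σ j) = G i j * C (d (σ j) : F)) :
    rowDeg H = rowDeg G := by
  funext i
  have hdeg : ∀ j, (H i (σ j)).natDegree = (G i j).natDegree := fun j => by
    rw [h, natDegree_mul_C (Units.ne_zero _)]
  simp only [rowDeg, ← hdeg]
  rw [← Finset.univ_map_equiv_to_embedding σ, Finset.sup_map]
  simp [Function.comp_def]

theorem ccfOutput_of_monomial {G H : Matrix (Fin k) (Fin n) F[X]} {σ : Equiv.Perm (Fin n)}
    {d : Fin n → Fˣ} (h : ∀ i j, H i (σ j) = G i j * C (d (σ j) : F)) (ν : Fin k → ℕ)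
    (x : (StateIdx ν → F) × (Fin k → F)) (j : Fin n) :
    ccfOutput ν H (σ j) x = ccfOutput ν G j x * d (σ j) := by
  simp [ccfOutput, Matrix.vecMul, dotProduct, ccfD, h, add_mul, Finset.sum_mul, mul_assoc]

theorem WAMfin_eq_of_monomial [DecidableEq F] {G H : Matrix (Fin k) (Fin n) F[X]}
    {σ : Equiv.Perm (Fin n)} {d : Fin n → Fˣ}
    (h : ∀ i j, H i (σ j) = G i j * C (d (σ j) : F))
    (hG : (∑ i, rowDeg G i) = δ) (hH : (∑ i, rowDeg H i) = δ)
    (X Y : Fin δ → F) (w : ℕ) : WAMfin G hG X Y w = WAMfin H hH X Y w := by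
  have hnorm : ∀ x, hammingNorm (fun j => ccfOutput (rowDeg G) G j x) =
      hammingNorm (fun j => ccfOutput (rowDeg G) H j x) := fun x =>
    Finset.card_equiv σ fun j => by simp [ccfOutput_of_monomial h]
  rw [WAMfin_eq_ncard G hG rfl hG, WAMfin_eq_ncard H hH (rowDeg_eq_of_monomial h) hG]
  simp only [hnorm]

theorem eq_mul_C_of_ccfOutput_eq_smul {G H : Matrix (Fin k) (Fin n) F[X]}
    (hdeg : rowDeg H = rowDeg G) {j j' : Fin n} {c : Fˣ}
    (h : ccfOutput (rowDeg G) H j' = c • ccfOutput (rowDeg G) G j) (i : Fin k) :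
    H i j' = G i j * C (c : F) := by
  ext a
  rw [coeff_mul_C]
  have hbound : ∀ (K : Matrix (Fin k) (Fin n) F[X]) l, (K i l).natDegree ≤ rowDeg K i :=
    fun K l => Finset.le_sup (f := fun j => (K i j).natDegree) (Finset.mem_univ l)
  rcases a with _ | a
  · have := LinearMap.congr_fun h (0, Pi.single i 1)
    rw [LinearMap.smul_apply, ccfOutput_single_input, ccfOutput_single_input] at this
    rw [this, Units.smul_def, smul_eq_mul, mul_comm]
  · by_cases ha : a < rowDeg G i
    · have := LinearMap.congr_fun h (Pi.single ⟨i, ⟨a, ha⟩⟩ 1, 0)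
      rw [LinearMap.smul_apply, ccfOutput_single_state, ccfOutput_single_state] at this
      rw [this, Units.smul_def, smul_eq_mul, mul_comm]
    · have hGj := hbound G j
      have hHj := hbound H j'
      rw [hdeg] at hHj
      rw [coeff_eq_zero_of_natDegree_lt (by omega), coeff_eq_zero_of_natDegree_lt (by omega),
        zero_mul]

end Monomial

/-- For basic reduced encoders of the same degree all of whose row degrees are
positive, monomial equivalence is the same as equality of the weight adjacency
matrices. -/
theorem stmt12 {F : Type*} [Field F] [Fintype F] [DecidableEq F] {k n δ : ℕ}
    (G Gbar : Matrix (Fin k) (Fin n) (Polynomial F))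
    (hG : IsBasic G) (hGred : IsRowReduced G)
    (hGbar : IsBasic Gbar) (hGbarred : IsRowReduced Gbar)
    (hpos : ∀ i, 0 < rowDeg G i) (hpos' : ∀ i, 0 < rowDeg Gbar i)
    (hdG : (∑ i, rowDeg G i) = δ) (hdGbar : (∑ i, rowDeg Gbar i) = δ) :
    (∃ M : Matrix (Fin n) (Fin n) F, IsMonomialMatrix M ∧
        Gbar = G * M.map (fun a => Polynomial.C a))
    ↔ ∀ (X Y : Fin δ → F) (w : ℕ), WAMfin G hdG X Y w = WAMfin Gbar hdGbar X Y w := by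
  constructor
  · rintro ⟨M, ⟨σ, d, hM⟩, rfl⟩ X Y w
    exact WAMfin_eq_of_monomial (fun i j => mul_map_C_monomial_apply G hM i j) hdG hdGbar X Y w
  · intro h
    have hdeg : rowDeg Gbar = rowDeg G :=
      (eq_of_range_blockStart_eq hpos hpos' (hdG.trans hdGbar.symm) <| subset_antisymm
        (range_blockStart_subset_of_WAMfin_eq hdG hdGbar h hpos hpos')
        (range_blockStart_subset_of_WAMfin_eq hdGbar hdG (fun X Y w => (h X Y w).symm)
          hpos' hpos)).symm
    have hnorm : ∀ x, hammingNorm (fun j => ccfOutput (rowDeg G) G j x) =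
        hammingNorm (fun j => ccfOutput (rowDeg G) Gbar j x) := by
      rintro ⟨x, u⟩
      have hlift := (stateEnc_bijective hdG).injective.surjective_comp_right (γ := F)
      obtain ⟨X, rfl⟩ := hlift x
      obtain ⟨Y, hY⟩ := hlift
        ((X ∘ stateEnc (rowDeg G) hdG) ᵥ* ccfA (rowDeg G) + u ᵥ* ccfB (rowDeg G))
      obtain ⟨v, hv, hw⟩ := exists_input_of_WAMfin_eq hdG hdGbar h hY.symm hdeg hdG
      obtain rfl : v = u := ccf_input_unique hpos (hv.trans hY)
      exact hw.symm
    obtain ⟨σ, d, hσ⟩ := exists_perm_smul_of_hammingNorm_eq hnorm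
    have hM : ∀ i j, (Matrix.of fun i j => if σ i = j then (d (σ.symm j) : F) else 0) i j =
        if σ i = j then ((fun j => d (σ.symm j)) j : F) else 0 := fun _ _ => rfl
    refine ⟨_, ⟨σ, _, hM⟩, ?_⟩
    ext1 i j
    obtain ⟨j, rfl⟩ := σ.surjective j
    rw [mul_map_C_monomial_apply G hM, eq_mul_C_of_ccfOutput_eq_smul hdeg (hσ j)]
    simp
end

section
/- Let R = F((z)) and let C, C̄ ⊆ R^n be k-dimensional R-codes with C = im_R G for a basic matrix G ∈ F[z]^{k×n}, and let φ : C → C̄ be an R-isometry. Then there exists a polynomial matrix Ḡ ∈ F[z]^{k×n} such that C̄ = im_R Ḡ and wt(uG) = wt(uḠ) for all u ∈ F[z]^k. -/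
open Matrix Polynomial

variable {F : Type*} [Field F]

/-- The weight of a polynomial row vector: the total number of nonzero
coefficients occurring in its entries. -/
def wtP {n : ℕ} (v : Fin n → Polynomial F) : ℕ := ∑ i, (v i).support.card

/-- The weight of a Laurent series row vector. -/
noncomputable def wtL {n : ℕ} (v : Fin n → LaurentSeries F) : ℕ∞ :=
  ∑ i, ((v i).support).encard

/-- The Laurent series code generated by a polynomial encoder `G`. -/
def codeOfLS {k n : ℕ} (G : Matrix (Fin k) (Fin n) (Polynomial F)) :
    Set (Fin n → LaurentSeries F) :=
  Set.range fun u : Fin k → LaurentSeries F =>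
    u ᵥ* (G.map fun p => algebraMap (Polynomial F) (LaurentSeries F) p)

/-- A `k`-dimensional code over the Laurent series field. -/
def IsLSCode {n : ℕ} (k : ℕ) (C : Submodule (LaurentSeries F) (Fin n → LaurentSeries F)) :
    Prop :=
  ∃ G : Matrix (Fin k) (Fin n) (Polynomial F),
    IsBasic G ∧ (C : Set (Fin n → LaurentSeries F)) = codeOfLS G


theorem coeff_algebraMap_laurentSeries (p : F[X]) (i : ℤ) :
    (algebraMap F[X] (LaurentSeries F) p).coeff i = if 0 ≤ i then p.coeff i.toNat else 0 := by
  rw [Polynomial.algebraMap_hahnSeries_apply]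
  change ((p : PowerSeries F) : LaurentSeries F).coeff i = _
  rw [PowerSeries.coeff_coe]
  split_ifs with h₁ h₂ h₂
  · omega
  · rfl
  · rw [Polynomial.coeff_coe]
    congr 1
    omega
  · omega

theorem encard_support_algebraMap (p : F[X]) :
    (algebraMap F[X] (LaurentSeries F) p).support.encard = p.support.card := by
  rw [← Set.encard_coe_eq_coe_finsetCard, ← (Nat.cast_injective (R := ℤ)).encard_image]
  congr 1
  ext i
  simp only [HahnSeries.mem_support, coeff_algebraMap_laurentSeries, Set.mem_image,
    Finset.mem_coe, Polynomial.mem_support_iff]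
  constructor
  · intro h
    split_ifs at h with hi
    · exact ⟨i.toNat, h, Int.toNat_of_nonneg hi⟩
    · exact absurd rfl h
  · rintro ⟨j, hj, rfl⟩
    simpa using hj

theorem wtL_algebraMap {n : ℕ} (v : Fin n → F[X]) :
    wtL (fun i => algebraMap F[X] (LaurentSeries F) (v i)) = wtP v := by
  simp only [wtL, wtP, encard_support_algebraMap, Nat.cast_sum]

theorem encard_support_single_mul (m : ℤ) (f : LaurentSeries F) :
    (HahnSeries.single m (1 : F) * f).support.encard = f.support.encard := by
  rw [← (add_left_injective m).encard_image f.support]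
  congr 1
  ext i
  simp [HahnSeries.coeff_single_mul, ← sub_eq_add_neg]

theorem wtL_single_smul {n : ℕ} (m : ℤ) (v : Fin n → LaurentSeries F) :
    wtL ((HahnSeries.single m (1 : F) : LaurentSeries F) • v) = wtL v := by
  simp [wtL, encard_support_single_mul]

/-- A Laurent series with finitely many terms becomes a polynomial after a sufficiently
large shift. -/
theorem exists_algebraMap_eq_single_mul {f : LaurentSeries F} (hf : f.support.Finite) {m : ℤ}
    (hm : -f.order ≤ m) :
    ∃ p : F[X], algebraMap F[X] (LaurentSeries F) p = HahnSeries.single m (1 : F) * f := by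
  refine ⟨∑ a ∈ hf.toFinset, monomial (a + m).toNat (f.coeff a), ?_⟩
  ext i
  have hord : ∀ a, f.coeff a ≠ 0 → 0 ≤ a + m := fun a ha => by
    have := HahnSeries.order_le_of_coeff_ne_zero ha
    omega
  simp only [coeff_algebraMap_laurentSeries, HahnSeries.coeff_single_mul, one_mul,
    Polynomial.finsetSum_coeff, coeff_monomial]
  split_ifs with hi
  · rw [Finset.sum_eq_single (i - m)]
    · simp
    · intro a ha hne
      have := hord a (by simpa using ha)
      rw [if_neg (by omega)]
    · simp
  · by_contra h
    have := hord (i - m) (Ne.symm h)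
    omega

theorem support_finite_of_wtL_ne_top {n : ℕ} {v : Fin n → LaurentSeries F} (hv : wtL v ≠ ⊤)
    (j : Fin n) : (v j).support.Finite := by
  rw [← Set.encard_ne_top_iff]
  exact fun h => hv (top_le_iff.mp (h ▸ Finset.single_le_sum
    (f := fun i => (v i).support.encard) (fun _ _ => zero_le) (Finset.mem_univ j)))

/-- Finitely many Laurent series vectors of finite weight have a common polynomial shift. -/
theorem exists_matrix_map_eq_single_smul {k n : ℕ} (w : Fin k → Fin n → LaurentSeries F)
    (hw : ∀ i, wtL (w i) ≠ ⊤) :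
    ∃ (m : ℤ) (H : Matrix (Fin k) (Fin n) F[X]), ∀ i,
      (H.map fun p => algebraMap F[X] (LaurentSeries F) p) i =
        (HahnSeries.single m (1 : F) : LaurentSeries F) • w i := by
  obtain ⟨m, hm⟩ := (Set.finite_range fun ij : Fin k × Fin n => -(w ij.1 ij.2).order).bddAbove
  choose p hp using fun i j => exists_algebraMap_eq_single_mul
    (support_finite_of_wtL_ne_top (hw i) j) (hm ⟨(i, j), rfl⟩)
  exact ⟨m, Matrix.of p, fun i => funext fun j => hp i j⟩

theorem vecMul_map_algebraMap {k n : ℕ} (G : Matrix (Fin k) (Fin n) F[X]) (u : Fin k → F[X]) :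
    (fun i => algebraMap F[X] (LaurentSeries F) (u i)) ᵥ*
        (G.map fun p => algebraMap F[X] (LaurentSeries F) p) =
      fun j => algebraMap F[X] (LaurentSeries F) ((u ᵥ* G) j) :=
  funext fun j => (RingHom.map_vecMul (algebraMap F[X] (LaurentSeries F)) G u j).symm


/-- An `R`-isometry between Laurent series codes is induced by a pair of polynomial
encoders that assign equal weights to all polynomial messages. -/
theorem stmt15 {F : Type*} [Field F] [Fintype F] {k n : ℕ}
    (C Cbar : Submodule (LaurentSeries F) (Fin n → LaurentSeries F))
    (G : Matrix (Fin k) (Fin n) (Polynomial F)) (hG : IsBasic G)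
    (hCG : (C : Set (Fin n → LaurentSeries F)) = codeOfLS G)
    (hCbar : IsLSCode k Cbar)
    (φ : C ≃ₗ[LaurentSeries F] Cbar)
    (hφ : ∀ v : C, wtL ((φ v : Fin n → LaurentSeries F)) = wtL (v : Fin n → LaurentSeries F)) :
    ∃ Gbar : Matrix (Fin k) (Fin n) (Polynomial F),
      (Cbar : Set (Fin n → LaurentSeries F)) = codeOfLS Gbar ∧
      ∀ u : Fin k → Polynomial F, wtP (u ᵥ* G) = wtP (u ᵥ* Gbar) := by
  set M := G.map fun p => algebraMap F[X] (LaurentSeries F) p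
  have hmem : ∀ u : Fin k → LaurentSeries F, u ᵥ* M ∈ C := fun u => by
    rw [← SetLike.mem_coe, hCG]
    exact ⟨u, rfl⟩
  have hrow : ∀ i, M i ∈ C := fun i => by
    simpa [Matrix.single_one_vecMul, Matrix.row] using hmem (Pi.single i 1)
  obtain ⟨m, H, hH⟩ := exists_matrix_map_eq_single_smul
    (fun i => (φ ⟨M i, hrow i⟩ : Fin n → LaurentSeries F)) fun i => by
      rw [hφ]
      exact (wtL_algebraMap (G i)).trans_ne (ENat.natCast_ne_top _)
  have key : ∀ u : Fin k → LaurentSeries F,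
      u ᵥ* (H.map fun p => algebraMap F[X] (LaurentSeries F) p) =
        (HahnSeries.single m (1 : F) : LaurentSeries F) •
          (φ ⟨u ᵥ* M, hmem u⟩ : Fin n → LaurentSeries F) := fun u => by
    have hsum : (⟨u ᵥ* M, hmem u⟩ : C) = ∑ i, u i • ⟨M i, hrow i⟩ := by
      ext1
      simp [Matrix.vecMul_eq_sum]
    rw [hsum, map_sum, Matrix.vecMul_eq_sum]
    simp only [hH, map_smul, Submodule.coe_sum, Submodule.coe_smul, Finset.smul_sum]
    exact Finset.sum_congr rfl fun i _ => smul_comm _ _ _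
  refine ⟨H, Set.Subset.antisymm ?_ ?_, fun u => ?_⟩
  · intro x hx
    obtain ⟨u, hu⟩ : (φ.symm ((HahnSeries.single (-m) (1 : F) : LaurentSeries F) • ⟨x, hx⟩) :
        Fin n → LaurentSeries F) ∈ codeOfLS G := hCG ▸ Subtype.coe_prop _
    refine ⟨u, (key u).trans ?_⟩
    have hu' : (⟨u ᵥ* M, hmem u⟩ : C) = φ.symm _ := Subtype.ext hu
    rw [hu', LinearEquiv.apply_symm_apply, Submodule.coe_smul, smul_smul,
      HahnSeries.single_mul_single]
    simp
  · rintro _ ⟨u, rfl⟩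
    simp only [key]
    exact Cbar.smul_mem _ (Subtype.coe_prop _)
  · rw [← Nat.cast_inj (R := ℕ∞), ← wtL_algebraMap, ← wtL_algebraMap,
      ← vecMul_map_algebraMap, ← vecMul_map_algebraMap, key, wtL_single_smul, hφ]
end

section
/- Let R = F((z)) and let C, C̄ ⊆ R^n be k-dimensional R-codes. If there exists an R-isometry φ : C → C̄, then C and C̄ are z-monomially equivalent, i.e. there exists a z-monomial matrix M over R such that C̄ = {vM : v ∈ C}. -/
open Matrix Polynomial

variable {F : Type*} [Field F]

/-- A `z`-monomial matrix over the Laurent series field. -/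
def IsZMonomialLS {n : ℕ} (M : Matrix (Fin n) (Fin n) (LaurentSeries F)) : Prop :=
  ∃ (σ : Equiv.Perm (Fin n)) (α : Fin n → Fˣ) (μ : Fin n → ℤ),
    ∀ i j, M i j = if σ i = j then HahnSeries.single (μ j) (α j : F) else 0


section Functionals

variable {K W X Y : Type*} [Field K] [AddCommGroup W] [Module K W]

lemma card_mul_card_ne_zero_of_ne_zero_s16 [Finite W] {f : W →ₗ[K] K} (hf : f ≠ 0) :
    Nat.card K * Nat.card {w // f w ≠ 0} = (Nat.card K - 1) * Nat.card W := by
  have hq : Nat.card (W ⧸ LinearMap.ker f) = Nat.card K :=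
    Nat.card_congr (f.quotKerEquivOfSurjective (LinearMap.surjective hf)).toEquiv
  have h1 := (LinearMap.ker f).toAddSubgroup.card_eq_card_quotient_mul_card_addSubgroup
  have h2 : Nat.card (W ⧸ (LinearMap.ker f).toAddSubgroup) = Nat.card K := hq
  have h3 : Nat.card (LinearMap.ker f).toAddSubgroup = Nat.card {w // f w = 0} := rfl
  rw [h2, h3] at h1
  have h4 : Nat.card {w // f w = 0} + Nat.card {w // f w ≠ 0} = Nat.card W := by
    rw [← Nat.card_sum]
    classical exact Nat.card_congr (Equiv.sumCompl _)
  rw [Nat.sub_mul, one_mul]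
  rw [← h4] at h1 ⊢
  rw [Nat.mul_add]
  omega

lemma finite_setOf_exists_mem_ne_zero {Λ : X → W →ₗ[K] K} (hΛ : ∀ w, {x | Λ x w ≠ 0}.Finite)
    (V : Submodule K W) [Finite V] : {x | ∃ v ∈ V, Λ x v ≠ 0}.Finite := by
  have : {x | ∃ v ∈ V, Λ x v ≠ 0} = ⋃ v : V, {x | Λ x v ≠ 0} := by
    ext x; simp
  rw [this]
  exact Set.finite_iUnion fun v => hΛ v

lemma card_mul_sum_ncard_ne_zero {Λ : X → W →ₗ[K] K} (hΛ : ∀ w, {x | Λ x w ≠ 0}.Finite)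
    (V : Submodule K W) [Fintype V] :
    Nat.card K * ∑ v : V, {x | Λ x v ≠ 0}.ncard =
      {x | ∃ v ∈ V, Λ x v ≠ 0}.ncard * ((Nat.card K - 1) * Nat.card V) := by
  classical
  have hfin := finite_setOf_exists_mem_ne_zero hΛ V
  have h1 : ∑ v : V, {x | Λ x v ≠ 0}.ncard =
      ∑ x ∈ hfin.toFinset, Nat.card {v : V // Λ x v ≠ 0} := by
    have := Finset.sum_card_bipartiteAbove_eq_sum_card_bipartiteBelow
      (s := (Finset.univ : Finset V)) (t := hfin.toFinset) (fun (v : V) x => Λ x v ≠ 0)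
    convert this using 2 with v _ x _
    · rw [← Set.ncard_coe_finset]
      congr 1
      ext x
      simp only [Set.mem_ofPred_eq, Finset.bipartiteAbove, Finset.coe_filter,
        Set.Finite.mem_toFinset]
      exact ⟨fun h => ⟨⟨v, v.2, h⟩, h⟩, fun h => h.2⟩
    · rw [Nat.card_eq_fintype_card, Fintype.card_subtype, Finset.bipartiteBelow]
  rw [h1, Finset.mul_sum, Set.ncard_eq_toFinset_card _ hfin, ← smul_eq_mul (Finset.card _),
    ← Finset.sum_const]
  refine Finset.sum_congr rfl fun x hx => ?_
  obtain ⟨v, hv, hxv⟩ := hfin.mem_toFinset.1 hx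
  exact card_mul_card_ne_zero_of_ne_zero_s16 (f := (Λ x).domRestrict V)
    fun h => hxv (LinearMap.congr_fun h ⟨v, hv⟩)

variable {Λ : X → W →ₗ[K] K} {Θ : Y → W →ₗ[K] K}

lemma ncard_exists_mem_ne_zero_eq [Finite K] (hΛ : ∀ w, {x | Λ x w ≠ 0}.Finite)
    (hΘ : ∀ w, {y | Θ y w ≠ 0}.Finite)
    (h : ∀ w, {x | Λ x w ≠ 0}.ncard = {y | Θ y w ≠ 0}.ncard)
    (V : Submodule K W) [Finite V] :
    {x | ∃ v ∈ V, Λ x v ≠ 0}.ncard = {y | ∃ v ∈ V, Θ y v ≠ 0}.ncard := by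
  have := Fintype.ofFinite V
  have h1 := card_mul_sum_ncard_ne_zero hΛ V
  simp only [h, card_mul_sum_ncard_ne_zero hΘ V] at h1
  have hK : 1 < Nat.card K := Finite.one_lt_card
  exact (Nat.eq_of_mul_eq_mul_right (Nat.mul_pos (by omega) Nat.card_pos) h1).symm

lemma setOf_exists_eq_smul_on_eq_sdiff (Λ : X → W →ₗ[K] K) {l : W →ₗ[K] K}
    {U : Submodule K W} {u : W} (hu : u ∈ U) (hlu : l u ≠ 0) :
    {x | ∃ a : Kˣ, ∀ v ∈ U, Λ x v = a * l v} =
      {x | ∃ v ∈ U, Λ x v ≠ 0} \ {x | ∃ v ∈ U ⊓ LinearMap.ker l, Λ x v ≠ 0} := by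
  ext x
  simp only [Set.mem_ofPred_eq, Set.mem_sdiff, Submodule.mem_inf, LinearMap.mem_ker, not_exists,
    not_and, not_not]
  constructor
  · rintro ⟨a, ha⟩
    refine ⟨⟨u, hu, ?_⟩, ?_⟩
    · rw [ha u hu]
      exact mul_ne_zero a.ne_zero hlu
    · rintro v ⟨hv, hlv⟩
      rw [ha v hv, hlv, mul_zero]
  · rintro ⟨⟨w, hw, hxw⟩, h0⟩
    have key : ∀ v ∈ U, Λ x v = Λ x u / l u * l v := fun v hv => by
      have := h0 (v - (l v / l u) • u) ⟨U.sub_mem hv (U.smul_mem _ hu), by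
        simp [div_mul_cancel₀ _ hlu]⟩
      simp only [map_sub, map_smul, smul_eq_mul, sub_eq_zero] at this
      rw [this]
      ring
    have hxu : Λ x u ≠ 0 := fun h => hxw (by rw [key w hw, h]; simp)
    exact ⟨Units.mk0 _ (div_ne_zero hxu hlu), key⟩

lemma ncard_exists_eq_smul_on (hΛ : ∀ w, {x | Λ x w ≠ 0}.Finite)
    (U : Submodule K W) [Finite U] {l : W →ₗ[K] K} {u : W} (hu : u ∈ U) (hlu : l u ≠ 0) :
    {x | ∃ a : Kˣ, ∀ v ∈ U, Λ x v = a * l v}.ncard =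
      {x | ∃ v ∈ U, Λ x v ≠ 0}.ncard - {x | ∃ v ∈ U ⊓ LinearMap.ker l, Λ x v ≠ 0}.ncard := by
  have : Finite ↥(U ⊓ LinearMap.ker l) :=
    Finite.of_injective _ (Submodule.inclusion_injective (inf_le_left : U ⊓ LinearMap.ker l ≤ U))
  have hsub : {x | ∃ v ∈ U ⊓ LinearMap.ker l, Λ x v ≠ 0} ⊆ {x | ∃ v ∈ U, Λ x v ≠ 0} :=
    fun x ⟨v, hv, hx⟩ => ⟨v, hv.1, hx⟩
  rw [setOf_exists_eq_smul_on_eq_sdiff Λ hu hlu,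
    Set.ncard_sdiff hsub (finite_setOf_exists_mem_ne_zero hΛ _)]

lemma ncard_exists_eq_smul_on_eq [Finite K] (hΛ : ∀ w, {x | Λ x w ≠ 0}.Finite)
    (hΘ : ∀ w, {y | Θ y w ≠ 0}.Finite)
    (h : ∀ w, {x | Λ x w ≠ 0}.ncard = {y | Θ y w ≠ 0}.ncard)
    (U : Submodule K W) [Finite U] {l : W →ₗ[K] K} {u : W} (hu : u ∈ U) (hlu : l u ≠ 0) :
    {x | ∃ a : Kˣ, ∀ v ∈ U, Λ x v = a * l v}.ncard =
      {y | ∃ a : Kˣ, ∀ v ∈ U, Θ y v = a * l v}.ncard := by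
  have : Finite ↥(U ⊓ LinearMap.ker l) :=
    Finite.of_injective _ (Submodule.inclusion_injective (inf_le_left : U ⊓ LinearMap.ker l ≤ U))
  rw [ncard_exists_eq_smul_on hΛ U hu hlu, ncard_exists_eq_smul_on hΘ U hu hlu,
    ncard_exists_mem_ne_zero_eq hΛ hΘ h, ncard_exists_mem_ne_zero_eq hΛ hΘ h]

/-- A MacWilliams type theorem: two pointwise finite families of functionals which have the same
number of nonvanishing members at every vector have the same number of members in each
projective class. -/
theorem ncard_exists_eq_smul_eq [Finite K] (hΛ : ∀ w, {x | Λ x w ≠ 0}.Finite)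
    (hΘ : ∀ w, {y | Θ y w ≠ 0}.Finite)
    (h : ∀ w, {x | Λ x w ≠ 0}.ncard = {y | Θ y w ≠ 0}.ncard) {l : W →ₗ[K] K} (hl : l ≠ 0) :
    {x | ∃ a : Kˣ, ∀ v, Λ x v = a * l v}.ncard = {y | ∃ a : Kˣ, ∀ v, Θ y v = a * l v}.ncard := by
  obtain ⟨u, hu⟩ : ∃ u, l u ≠ 0 := by
    by_contra! h0
    exact hl (LinearMap.ext h0)
  have hw : ∀ f : W →ₗ[K] K, ∃ w, f w = f u / l u * l w → ∀ v, f v = f u / l u * l v := by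
    intro f
    by_contra! h0
    obtain ⟨-, v, hv⟩ := h0 0
    exact hv (h0 v).1
  choose w hw using hw
  let S : Set W := {u} ∪ ((fun x => w (Λ x)) '' {x | Λ x u ≠ 0} ∪
    (fun y => w (Θ y)) '' {y | Θ y u ≠ 0})
  have hS : S.Finite := (Set.finite_singleton u).union
    (((hΛ u).image _).union ((hΘ u).image _))
  have : Module.Finite K (Submodule.span K S) := Module.Finite.span_of_finite K hS
  have : Finite (Submodule.span K S) := Module.finite_of_finite K
  have huS : u ∈ Submodule.span K S := Submodule.subset_span (Or.inl rfl)
  have key : ∀ f : W →ₗ[K] K, (f u ≠ 0 → w f ∈ S) →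
      ((∃ a : Kˣ, ∀ v ∈ Submodule.span K S, f v = a * l v) ↔ ∃ a : Kˣ, ∀ v, f v = a * l v) := by
    refine fun f hf => ⟨fun ⟨a, ha⟩ => ?_, fun ⟨a, ha⟩ => ⟨a, fun v _ => ha v⟩⟩
    have hau : f u / l u = a := by rw [ha u huS, mul_div_cancel_right₀ _ hu]
    have hfu : f u ≠ 0 := by
      rw [ha u huS]
      exact mul_ne_zero a.ne_zero hu
    refine ⟨a, hau ▸ hw f ?_⟩
    rw [hau]
    exact ha _ (Submodule.subset_span (hf hfu))
  have := ncard_exists_eq_smul_on_eq hΛ hΘ h _ huS hu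
  have hX : {x | ∃ a : Kˣ, ∀ v ∈ Submodule.span K S, Λ x v = a * l v} =
      {x | ∃ a : Kˣ, ∀ v, Λ x v = a * l v} :=
    Set.ext fun x => key _ fun hx => Or.inr (Or.inl ⟨x, hx, rfl⟩)
  have hY : {y | ∃ a : Kˣ, ∀ v ∈ Submodule.span K S, Θ y v = a * l v} =
      {y | ∃ a : Kˣ, ∀ v, Θ y v = a * l v} :=
    Set.ext fun y => key _ fun hy => Or.inr (Or.inr ⟨y, hy, rfl⟩)
  rwa [hX, hY] at this

end Functionals

section Columns

variable {K m ι : Type*} [Field K]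

lemma single_mul_single_inv (a : Kˣ) (t : ℤ) :
    (HahnSeries.single (-t) (↑a⁻¹ : K) * HahnSeries.single t (a : K) : LaurentSeries K) = 1 := by
  rw [HahnSeries.single_mul_single, neg_add_cancel, Units.inv_mul]
  rfl

/-- Two columns of Laurent series are shift equivalent if they differ by a factor `α z ^ μ`
with a nonzero scalar `α`. -/
def shiftSetoid (K m : Type*) [Field K] : Setoid (m → LaurentSeries K) where
  r c d := ∃ (a : Kˣ) (t : ℤ), d = (HahnSeries.single t (a : K) : LaurentSeries K) • c
  iseqv :=
    { refl := fun c => ⟨1, 0, by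
        have : (HahnSeries.single (0 : ℤ) ((1 : Kˣ) : K) : LaurentSeries K) = 1 := rfl
        rw [this, one_smul]⟩
      symm := by
        rintro c _ ⟨a, t, rfl⟩
        exact ⟨a⁻¹, -t, by rw [smul_smul, single_mul_single_inv, one_smul]⟩
      trans := by
        rintro c _ _ ⟨a, t, rfl⟩ ⟨b, s, rfl⟩
        exact ⟨b * a, s + t, by rw [smul_smul, HahnSeries.single_mul_single, Units.val_mul]⟩ }

lemma eq_of_single_smul_eq_single_smul {c : m → LaurentSeries K} (hc : c ≠ 0) {a b : Kˣ} {s t : ℤ}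
    (h : (HahnSeries.single s (a : K) : LaurentSeries K) • c =
      (HahnSeries.single t (b : K) : LaurentSeries K) • c) :
    s = t := by
  have h1 : (HahnSeries.single s (a : K) : LaurentSeries K) = HahnSeries.single t (b : K) :=
    smul_left_injective _ hc h
  have h2 := congrArg HahnSeries.order h1
  rwa [HahnSeries.order_single a.ne_zero, HahnSeries.order_single b.ne_zero] at h2

lemma ncard_setOf_exists_eq_single_smul (h : ι → m → LaurentSeries K) {c : m → LaurentSeries K}
    (hc : c ≠ 0) :
    {x : ι × ℤ | ∃ a : Kˣ, h x.1 = (HahnSeries.single x.2 (a : K) : LaurentSeries K) • c}.ncard =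
      {i | shiftSetoid K m c (h i)}.ncard := by
  have hinj : Set.InjOn Prod.fst
      {x : ι × ℤ | ∃ a : Kˣ, h x.1 = (HahnSeries.single x.2 (a : K) : LaurentSeries K) • c} := by
    rintro ⟨i, s⟩ ⟨a, ha⟩ ⟨j, t⟩ ⟨b, hb⟩ (rfl : i = j)
    exact Prod.ext rfl (eq_of_single_smul_eq_single_smul hc (ha.symm.trans hb))
  rw [← hinj.ncard_image]
  congr 1
  ext i
  constructor
  · rintro ⟨⟨i, t⟩, ⟨a, ha⟩, rfl⟩
    exact ⟨a, t, ha⟩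
  · rintro ⟨a, t, ha⟩
    exact ⟨(i, t), ⟨a, ha⟩, rfl⟩

/-- The number of nonzero coefficients of a family is its total weight. -/
lemma encard_setOf_coeff_ne_zero [Fintype ι] (f : ι → LaurentSeries K) :
    {x : ι × ℤ | (f x.1).coeff x.2 ≠ 0}.encard = ∑ i, (f i).support.encard := by
  have h1 : {x : ι × ℤ | (f x.1).coeff x.2 ≠ 0} = ⋃ i, Prod.mk i '' (f i).support := by
    ext ⟨i, t⟩
    simp
  rw [h1, Set.encard_iUnion_of_finite, finsum_eq_sum_of_fintype]
  · exact Finset.sum_congr rfl fun i _ => (Prod.mk_right_injective i).encard_image _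
  · intro i j hij
    rw [Function.onFun, Set.disjoint_left]
    rintro _ ⟨s, -, rfl⟩ ⟨t, -, h⟩
    exact hij (congrArg Prod.fst h).symm

variable [Fintype m]

lemma smul_dotProduct_laurentSeries (a : K) (u c : m → LaurentSeries K) :
    (a • u) ⬝ᵥ c = a • (u ⬝ᵥ c) := by
  simp only [dotProduct, Pi.smul_apply, ← HahnSeries.C_mul_eq_smul, Finset.mul_sum, mul_assoc]

/-- The functional sending a row `u` to the coefficient of `z ^ t` in its product with the
column `c`. -/
noncomputable def coeffDot (c : m → LaurentSeries K) (t : ℤ) : (m → LaurentSeries K) →ₗ[K] K where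
  toFun u := (u ⬝ᵥ c).coeff t
  map_add' u v := by rw [add_dotProduct, HahnSeries.coeff_add]
  map_smul' a u := by rw [smul_dotProduct_laurentSeries, HahnSeries.coeff_smul, RingHom.id_apply]

lemma coeffDot_apply (c : m → LaurentSeries K) (t : ℤ) (u : m → LaurentSeries K) :
    coeffDot c t u = (u ⬝ᵥ c).coeff t := rfl

lemma coeffDot_piSingle [DecidableEq m] (c : m → LaurentSeries K) (t s : ℤ) (l : m) :
    coeffDot c t (Pi.single l (HahnSeries.single s 1)) = (c l).coeff (t - s) := by
  rw [coeffDot_apply, single_dotProduct, HahnSeries.coeff_single_mul, one_mul]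

/-- The rows whose products with all columns in `G` are Laurent polynomials. -/
def finiteRows (G : ι → m → LaurentSeries K) : Submodule K (m → LaurentSeries K) where
  carrier := {u | ∀ i, (u ⬝ᵥ G i).support.Finite}
  add_mem' hu hv i := by
    rw [add_dotProduct]
    exact ((hu i).union (hv i)).subset (HahnSeries.support_add_subset _ _)
  zero_mem' i := by simp
  smul_mem' a u hu i := by
    rw [smul_dotProduct_laurentSeries]
    exact (hu i).subset (HahnSeries.support_smul_subset a _)

lemma piSingle_mem_finiteRows [DecidableEq m] {G : ι → m → LaurentSeries K}
    (hG : ∀ i l, (G i l).support.Finite) (l : m) (s : ℤ) :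
    Pi.single l (HahnSeries.single s 1) ∈ finiteRows G := by
  intro i
  rw [single_dotProduct]
  refine ((hG i l).image (· + s)).subset fun t ht => ⟨t - s, ?_, by simp⟩
  simpa [HahnSeries.mem_support, HahnSeries.coeff_single_mul] using ht

lemma exists_coeffDot_eq_mul_iff [DecidableEq m] {W : Submodule K (m → LaurentSeries K)}
    (hW : ∀ (l : m) (s : ℤ), Pi.single l (HahnSeries.single s 1) ∈ W)
    (c d : m → LaurentSeries K) (t : ℤ) :
    (∃ a : Kˣ, ∀ v : W, coeffDot d t v = a * coeffDot c 0 v) ↔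
      ∃ a : Kˣ, d = (HahnSeries.single t (a : K) : LaurentSeries K) • c := by
  refine exists_congr fun a => ⟨fun h => ?_, ?_⟩
  · ext l p
    have := h ⟨_, hW l (t - p)⟩
    simp only [coeffDot_piSingle] at this
    rw [Pi.smul_apply, smul_eq_mul, HahnSeries.coeff_single_mul]
    simpa using this
  · rintro rfl v
    rw [coeffDot_apply, coeffDot_apply, dotProduct_smul, smul_eq_mul,
      HahnSeries.coeff_single_mul, sub_self]

variable [Finite K] [Fintype ι] {G H : ι → m → LaurentSeries K}

lemma ncard_shiftSetoid_eq (hG : ∀ i l, (G i l).support.Finite)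
    (h : ∀ u : m → LaurentSeries K,
      ∑ i, (u ⬝ᵥ G i).support.encard = ∑ i, (u ⬝ᵥ H i).support.encard)
    {c : m → LaurentSeries K} (hc : c ≠ 0) :
    {i | shiftSetoid K m c (G i)}.ncard = {i | shiftSetoid K m c (H i)}.ncard := by
  classical
  have hW := piSingle_mem_finiteRows hG
  let functional (E : ι → m → LaurentSeries K) (x : ι × ℤ) : finiteRows G →ₗ[K] K :=
    (coeffDot (E x.1) x.2).domRestrict (finiteRows G)
  have hcard (E : ι → m → LaurentSeries K) (w : finiteRows G) :
      {x | functional E x w ≠ 0}.encard = ∑ i, (w.1 ⬝ᵥ E i).support.encard :=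
    encard_setOf_coeff_ne_zero fun i => w.1 ⬝ᵥ E i
  have hEq (w : finiteRows G) :
      {x | functional G x w ≠ 0}.encard = {x | functional H x w ≠ 0}.encard := by
    rw [hcard, hcard, h]
  have hfin (w : finiteRows G) : {x | functional G x w ≠ 0}.Finite := by
    rw [← Set.encard_ne_top_iff, hcard, ← lt_top_iff_ne_top]
    exact WithTop.sum_lt_top.2 fun i _ => (w.2 i).encard_lt_top
  have hfin' (w : finiteRows G) : {x | functional H x w ≠ 0}.Finite := by
    rw [← Set.encard_ne_top_iff, ← hEq, Set.encard_ne_top_iff]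
    exact hfin w
  have hl : (coeffDot c 0).domRestrict (finiteRows G) ≠ 0 := by
    intro h0
    refine hc (funext fun l => HahnSeries.ext (funext fun p => ?_))
    have := LinearMap.congr_fun h0 ⟨_, hW l (-p)⟩
    rw [LinearMap.domRestrict_apply, coeffDot_piSingle] at this
    simpa using this
  have key := ncard_exists_eq_smul_eq hfin hfin' (fun w => congrArg ENat.toNat (hEq w)) hl
  have hset (E : ι → m → LaurentSeries K) :
      {x | ∃ a : Kˣ, ∀ v, functional E x v = a * (coeffDot c 0).domRestrict (finiteRows G) v} =
        {x : ι × ℤ | ∃ a : Kˣ, E x.1 = (HahnSeries.single x.2 (a : K) : LaurentSeries K) • c} :=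
    Set.ext fun x => exists_coeffDot_eq_mul_iff hW c (E x.1) x.2
  rwa [hset, hset, ncard_setOf_exists_eq_single_smul G hc,
    ncard_setOf_exists_eq_single_smul H hc] at key

/-- Families of columns inducing the same weights agree up to a permutation and shift
equivalence. -/
theorem exists_perm_shiftSetoid (hG : ∀ i l, (G i l).support.Finite)
    (h : ∀ u : m → LaurentSeries K,
      ∑ i, (u ⬝ᵥ G i).support.encard = ∑ i, (u ⬝ᵥ H i).support.encard) :
    ∃ σ : Equiv.Perm ι, ∀ i, shiftSetoid K m (G i) (H (σ i)) := by
  classical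
  have hzero {c d : m → LaurentSeries K} (hcd : shiftSetoid K m c d) (hc : c ≠ 0) : d ≠ 0 := by
    rintro rfl
    obtain ⟨a, t, ha⟩ := (shiftSetoid K m).symm hcd
    exact hc (by rw [ha, smul_zero])
  have hfiber (E : ι → m → LaurentSeries K) {c : m → LaurentSeries K} (hc : c ≠ 0) :
      Nat.card {a : {i // E i ≠ 0} // Quotient.mk (shiftSetoid K m) (E a) = Quotient.mk _ c} =
        {i | shiftSetoid K m c (E i)}.ncard := by
    rw [← Nat.card_coe_set_eq]
    exact Nat.card_congr
      { toFun := fun a => ⟨a.1.1, (shiftSetoid K m).symm (Quotient.exact a.2)⟩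
        invFun := fun i => ⟨⟨i.1, hzero i.2 hc⟩, Quotient.sound ((shiftSetoid K m).symm i.2)⟩
        left_inv := fun _ => rfl
        right_inv := fun _ => rfl }
  have hempty (E : ι → m → LaurentSeries K) :
      IsEmpty {a : {i // E i ≠ 0} //
        Quotient.mk (shiftSetoid K m) (E a) = Quotient.mk _ 0} :=
    ⟨fun a => hzero (Quotient.exact a.2) a.1.2 rfl⟩
  have hequiv (q : Quotient (shiftSetoid K m)) :
      Nonempty ({a : {i // G i ≠ 0} // Quotient.mk (shiftSetoid K m) (G a) = q} ≃
        {a : {i // H i ≠ 0} // Quotient.mk (shiftSetoid K m) (H a) = q}) := by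
    induction q using Quotient.inductionOn with
    | h c =>
      by_cases hc : c = 0
      · subst hc
        have := hempty G
        have := hempty H
        exact ⟨Equiv.equivOfIsEmpty _ _⟩
      · rw [← Finite.card_eq, hfiber G hc, hfiber H hc, ncard_shiftSetoid_eq hG h hc]
  let e := Equiv.ofFiberEquiv fun q => (hequiv q).some
  refine ⟨e.extendSubtype, fun i => ?_⟩
  by_cases hi : G i = 0
  · have hHi : H (e.extendSubtype i) = 0 :=
      not_not.1 (e.extendSubtype_not_mem i (not_not.2 hi))
    rw [hi, hHi]
  · rw [e.extendSubtype_apply_of_mem i hi]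
    exact (shiftSetoid K m).symm
      (Quotient.exact (Equiv.ofFiberEquiv_map (fun q => (hequiv q).some) ⟨i, hi⟩))

end Columns

lemma support_algebraMap_finite {K : Type*} [Field K] (p : Polynomial K) :
    (algebraMap (Polynomial K) (LaurentSeries K) p).support.Finite := by
  rw [Polynomial.algebraMap_hahnSeries_apply]
  refine (p.support.finite_toSet.image (fun n : ℕ => (n : ℤ))).subset fun t ht => ?_
  by_contra hn
  refine ht ?_
  by_cases hr : t ∈ Set.range (fun n : ℕ => (n : ℤ))
  · obtain ⟨n, rfl⟩ := hr
    rw [HahnSeries.ofPowerSeries_apply_coeff, Polynomial.coeff_coe]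
    by_contra h0
    exact hn ⟨n, by simpa using h0, rfl⟩
  · rw [HahnSeries.ofPowerSeries_apply]
    exact HahnSeries.embDomain_of_notMem_range (by simpa using hr)

theorem exists_isZMonomialLS_eq_mul {K : Type*} [Field K] [Finite K] {k n : ℕ}
    {G H : Matrix (Fin k) (Fin n) (LaurentSeries K)} (hG : ∀ l i, (G l i).support.Finite)
    (h : ∀ u : Fin k → LaurentSeries K, wtL (u ᵥ* G) = wtL (u ᵥ* H)) :
    ∃ M : Matrix (Fin n) (Fin n) (LaurentSeries K), IsZMonomialLS M ∧ H = G * M := by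
  obtain ⟨σ, hσ⟩ := exists_perm_shiftSetoid (G := fun i l => G l i) (H := fun i l => H l i)
    (fun i l => hG l i) h
  choose a t ht using hσ
  refine ⟨Matrix.of fun i j => if σ i = j then
    HahnSeries.single (t (σ.symm j)) (a (σ.symm j) : K) else 0,
    ⟨σ, a ∘ σ.symm, t ∘ σ.symm, fun i j => rfl⟩, ?_⟩
  ext1 l j
  obtain ⟨i, rfl⟩ := σ.surjective j
  rw [Matrix.mul_apply, Finset.sum_eq_single i]
  · have := congrFun (ht i) l
    simp only [Pi.smul_apply, smul_eq_mul] at this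
    rw [this, Matrix.of_apply, if_pos rfl, σ.symm_apply_apply, mul_comm]
  · intro b _ hb
    rw [Matrix.of_apply, if_neg (σ.injective.ne hb), mul_zero]
  · simp

/-- `R`-isometric Laurent series codes are `z`-monomially equivalent. -/
theorem stmt16 {F : Type*} [Field F] [Fintype F] {k n : ℕ}
    (C Cbar : Submodule (LaurentSeries F) (Fin n → LaurentSeries F))
    (hC : IsLSCode k C) (hCbar : IsLSCode k Cbar)
    (h : ∃ φ : C ≃ₗ[LaurentSeries F] Cbar,
      ∀ v : C, wtL ((φ v : Fin n → LaurentSeries F)) = wtL (v : Fin n → LaurentSeries F)) :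
    ∃ M : Matrix (Fin n) (Fin n) (LaurentSeries F), IsZMonomialLS M ∧
      (Cbar : Set (Fin n → LaurentSeries F)) =
        (fun v : Fin n → LaurentSeries F => v ᵥ* M) '' (C : Set (Fin n → LaurentSeries F)) := by
  obtain ⟨G, -, hG⟩ := hC
  obtain ⟨φ, hφ⟩ := h
  let A : Matrix (Fin k) (Fin n) (LaurentSeries F) :=
    G.map fun p => algebraMap (Polynomial F) (LaurentSeries F) p
  have hA (v : Fin n → LaurentSeries F) : v ∈ C ↔ ∃ u, u ᵥ* A = v := by
    rw [← SetLike.mem_coe, hG]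
    rfl
  let T : (Fin k → LaurentSeries F) →ₗ[LaurentSeries F] C :=
    (Matrix.vecMulLinear A).codRestrict C fun u => (hA _).2 ⟨u, rfl⟩
  let B : Matrix (Fin k) (Fin n) (LaurentSeries F) :=
    LinearMap.toMatrixRight' (Cbar.subtype ∘ₗ φ.toLinearMap ∘ₗ T)
  have hB (u : Fin k → LaurentSeries F) : u ᵥ* B = φ (T u) := by
    rw [← Matrix.toLinearMapRight'_apply]
    exact LinearMap.congr_fun (LinearMap.toMatrixRight'.symm_apply_apply _) u
  obtain ⟨M, hM, hBM⟩ := exists_isZMonomialLS_eq_mul (G := A) (H := B)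
    (fun l i => support_algebraMap_finite (G l i)) fun u => by
      rw [hB, hφ]
      rfl
  refine ⟨M, hM, Set.ext fun w => ⟨fun hw => ?_, ?_⟩⟩
  · obtain ⟨u, hu⟩ := (hA _).1 (φ.symm ⟨w, hw⟩).2
    refine ⟨u ᵥ* A, (hA _).2 ⟨u, rfl⟩, ?_⟩
    have hT : T u = φ.symm ⟨w, hw⟩ := Subtype.ext hu
    change (u ᵥ* A) ᵥ* M = w
    rw [Matrix.vecMul_vecMul, ← hBM, hB, hT, φ.apply_symm_apply]
  · rintro ⟨v, hv, rfl⟩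
    obtain ⟨u, rfl⟩ := (hA v).1 hv
    change (u ᵥ* A) ᵥ* M ∈ Cbar
    rw [Matrix.vecMul_vecMul, ← hBM, hB]
    exact (φ (T u)).2
end
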